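/- Let G be a finite group such that G = O_{2′,2,2′}(G), i.e. the quotient of G by O_{2′}(G) has a normal Sylow 2-subgroup whose quotient again has odd order. Then every real-valued irreducible character of G lying in the principal 2-block contains O_{2′}(G) in its kernel. In particular, the number of real-valued irreducible characters of G/O_{2′}(G) is at most the number of elements of a Sylow 2-subgroup S̄ of G/O_{2′}(G) that are inverted by conjugation within S̄. -/

import Mathlib

open CategoryTheory

/-- An irreducible complex character lies in the principal 2-block iff the sum of its
values over the 2-regular (odd-order) elements is nonzero. -/
def InPrincipal2Block {G : Type} [Group G] [Fintype G] (V : FDRep ℂ G) : Prop :=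
  (∑ g ∈ Finset.univ.filter (fun g : G => Odd (orderOf g)), V.character g) ≠ 0


section aux
variable {G : Type} [Group G] [Fintype G]

theorem aux_scalar {V : Type} [AddCommGroup V] [Module ℂ V] [FiniteDimensional ℂ V]
    (ρ : Representation ℂ G V)
    (h : ∑ g : G, ρ.character g * ρ.character g⁻¹ = Nat.card G) (T : V →ₗ[ℂ] V)
    (hT : ∀ g, T ∘ₗ ρ g = ρ g ∘ₗ T) : ∃ c : ℂ, T = c • LinearMap.id := by
  have hne : (Nat.card G : ℂ) ≠ 0 := by exact_mod_cast Nat.card_pos.ne'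
  have : Invertible (Nat.card G : ℂ) := invertibleOfNonzero hne
  have h1 := Representation.card_inv_mul_sum_char_mul_char_eq_finrank ρ ρ
  rw [h, inv_mul_cancel₀ hne] at h1
  have h2 : Module.finrank ℂ (Representation.IntertwiningMap ρ ρ) = 1 := by exact_mod_cast h1.symm
  let i : Representation.IntertwiningMap ρ ρ := ⟨LinearMap.id, fun g => by simp⟩
  have hi : i ≠ 0 := by
    intro hi
    have h0 : ∀ v : V, v = 0 := fun v => congrArg (fun (j : Representation.IntertwiningMap ρ ρ) => j v) hi
    have : Subsingleton (Representation.IntertwiningMap ρ ρ) := ⟨fun a b => by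
      ext v; rw [h0 v]; simp⟩
    rw [Module.finrank_zero_of_subsingleton] at h2
    exact absurd h2 (by norm_num)
  obtain ⟨c, hc⟩ := (finrank_eq_one_iff_of_nonzero' i hi).1 h2 ⟨T, fun g => by
    exact hT g⟩
  refine ⟨c, ?_⟩
  ext v
  exact (congrArg (fun (j : Representation.IntertwiningMap ρ ρ) => j v) hc).symm

theorem aux_central {V : Type} [AddCommGroup V] [Module ℂ V] 
    (ρ : Representation ℂ G V) (f : G → ℂ) (hf : ∀ g h, f (h * g * h⁻¹) = f g) (x : G) :
    (∑ g, f g • ρ g) ∘ₗ ρ x = ρ x ∘ₗ (∑ g, f g • ρ g) := by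
  have : ∑ g, f g • ρ (g * x) = ∑ g, f g • ρ (x * g) := by
    rw [← Equiv.sum_comp (MulAut.conj x).toEquiv]
    refine Finset.sum_congr rfl fun g _ => ?_
    simp [hf]
  ext v
  have := LinearMap.congr_fun this v
  simpa [LinearMap.sum_apply, map_sum] using this

theorem aux_simple (V : FDRep ℂ G) [Simple V] :
    ∑ g : G, V.character g * V.character g⁻¹ = Nat.card G := 
  FDRep.simple_iff_char_is_norm_one V |>.1 inferInstance

open scoped ComplexOrder in
theorem aux_conj (V : FDRep ℂ G) (g : G) : V.character g⁻¹ = star (V.character g) := by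
  classical
  let b := Module.finBasis ℂ V
  let A : G → Matrix _ _ ℂ := fun h => LinearMap.toMatrix b b (V.ρ h)
  have hmul : ∀ h k, A (h * k) = A h * A k := fun h k => by
    simp only [A, map_mul]; exact LinearMap.toMatrix_mul b _ _
  have h1 : A 1 = 1 := by simp [A]
  have htr : ∀ h, V.character h = (A h).trace := fun h => by
    exact LinearMap.trace_eq_matrix_trace ℂ b _
  let P := ∑ h, (A h).conjTranspose * A h
  have hP : P.PosDef := by
    have : P = (A 1).conjTranspose * A 1 + ∑ h ∈ Finset.univ.erase 1, (A h).conjTranspose * A h := by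
      rw [Finset.add_sum_erase _ (fun h => (A h).conjTranspose * A h) (Finset.mem_univ _)]
    rw [this, h1]
    refine Matrix.PosDef.add_posSemidef (by simpa using Matrix.PosDef.one) ?_
    exact Matrix.posSemidef_sum _ fun h _ => Matrix.posSemidef_conjTranspose_mul_self _
  have hinv : (A g).conjTranspose * P * A g = P := by
    simp only [P, Finset.mul_sum, Finset.sum_mul]
    rw [← Equiv.sum_comp (Equiv.mulRight g) (fun h => (A h).conjTranspose * A h)]
    refine Finset.sum_congr rfl fun h _ => ?_
    simp [hmul, Matrix.conjTranspose_mul, mul_assoc]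
  have hgi : A g * A g⁻¹ = 1 := by rw [← hmul]; simp [h1]
  have hu : IsUnit P.det := (Matrix.isUnit_iff_isUnit_det _).1 hP.isUnit
  have : A g⁻¹ = P⁻¹ * ((A g).conjTranspose * P) := by
    calc A g⁻¹ = P⁻¹ * P * A g⁻¹ := by rw [Matrix.nonsing_inv_mul _ hu, one_mul]
      _ = P⁻¹ * ((A g).conjTranspose * P * A g) * A g⁻¹ := by rw [hinv]
      _ = P⁻¹ * ((A g).conjTranspose * P) * (A g * A g⁻¹) := by simp only [mul_assoc]
      _ = _ := by rw [hgi, mul_one]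
  rw [htr, htr, this, Matrix.trace_mul_comm, mul_assoc, Matrix.mul_nonsing_inv _ hu, mul_one,
    Matrix.trace_conjTranspose]

theorem aux_trace {W ι : Type*} [AddCommGroup W] [Module ℂ W] [Finite ι] (b : Module.Basis ι ℂ W)
    (τ : W →ₗ[ℂ] W) (p : ι → ι) (h : ∀ i, τ (b i) = b (p i)) :
    LinearMap.trace ℂ W τ = Nat.card {i // p i = i} := by
  classical
  have := Fintype.ofFinite ι
  rw [LinearMap.trace_eq_matrix_trace ℂ b, Matrix.trace]
  simp only [Matrix.diag, LinearMap.toMatrix_apply, h, Module.Basis.repr_self, Finsupp.single_apply]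
  rw [Finset.sum_boole, Nat.card_eq_fintype_card, Fintype.card_subtype]

theorem aux_simpleModule (f : G → ℂ) (hf : ∀ g h, f (h * g * h⁻¹) = f g)
    (hV : ∀ V : FDRep ℂ G, Simple V → ∑ g, f g * V.character g = 0)
    {V : Type} [AddCommGroup V] [Module ℂ V] [FiniteDimensional ℂ V]
    (ρ : Representation ℂ G V) [ρ.IsIrreducible] : ∑ g, f g • ρ g = 0 := by
  classical
  have hne : (Nat.card G : ℂ) ≠ 0 := by exact_mod_cast Nat.card_pos.ne'
  have : Invertible (Nat.card G : ℂ) := invertibleOfNonzero hne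
  have h1 := Representation.char_orthonormal ρ ρ
  rw [if_pos ⟨Representation.Equiv.refl ρ⟩, inv_mul_eq_iff_eq_mul₀ hne, mul_one] at h1
  obtain ⟨c, hc⟩ := aux_scalar ρ h1 _ (aux_central ρ f hf)
  have hs : Simple (FDRep.of ρ) := (FDRep.simple_iff_char_is_norm_one _).2 h1
  have h2 := hV _ hs
  have h3 := congrArg (LinearMap.trace ℂ V) hc
  simp only [map_sum, map_smul, LinearMap.trace_id, smul_eq_mul] at h3
  have h4 : c * (Module.finrank ℂ V : ℂ) = 0 := h3.symm.trans h2
  rcases mul_eq_zero.1 h4 with h | h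
  · rw [hc, h, zero_smul]
  · have : Module.finrank ℂ V = 0 := by exact_mod_cast h
    have := Module.finrank_zero_iff.1 this
    exact Subsingleton.elim _ _

theorem aux_module (f : G → ℂ) (hf : ∀ g h, f (h * g * h⁻¹) = f g)
    (hV : ∀ V : FDRep ℂ G, Simple V → ∑ g, f g * V.character g = 0)
    (M : Type) [AddCommGroup M] [Module ℂ M] [Module (MonoidAlgebra ℂ G) M]
    [IsScalarTower ℂ (MonoidAlgebra ℂ G) M] [Module.Finite ℂ M]
    [hm : IsSimpleModule (MonoidAlgebra ℂ G) M] (x : M) :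
    (∑ g, MonoidAlgebra.single g (f g) : MonoidAlgebra ℂ G) • x = 0 := by
  let ρ : Representation ℂ G M := Representation.ofModule' M
  have hρ : ρ.asAlgebraHom = Algebra.lsmul ℂ ℂ M := by
    exact (MonoidAlgebra.lift ℂ (M →ₗ[ℂ] M) G).apply_symm_apply (Algebra.lsmul ℂ ℂ M)
  let e : ρ.asModule ≃ₗ[MonoidAlgebra ℂ G] M :=
    { ρ.asModuleEquiv with
      map_smul' := fun r m => by
        change ρ.asModuleEquiv (r • m) = r • ρ.asModuleEquiv m
        rw [Representation.asModuleEquiv_map_smul, hρ]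
        rfl }
  have : IsSimpleModule (MonoidAlgebra ℂ G) ρ.asModule := IsSimpleModule.congr e
  have := (Representation.irreducible_iff_isSimpleModule_asModule ρ).2 this
  have h := aux_simpleModule f hf hV ρ
  have h1 : ρ.asAlgebraHom (∑ g, MonoidAlgebra.single g (f g)) = 0 := by
    rw [← h, map_sum]
    refine Finset.sum_congr rfl fun g _ => ?_
    simp
  rw [hρ] at h1
  exact LinearMap.congr_fun h1 x

theorem aux_complete (f : G → ℂ) (hf : ∀ g h, f (h * g * h⁻¹) = f g)
    (hV : ∀ V : FDRep ℂ G, Simple V → ∑ g, f g * V.character g = 0) : f = 0 := by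
  classical
  have hne : (Nat.card G : ℂ) ≠ 0 := by exact_mod_cast Nat.card_pos.ne'
  have : NeZero (Nat.card G : ℂ) := ⟨hne⟩
  let a : MonoidAlgebra ℂ G := ∑ g, MonoidAlgebra.single g (f g)
  have : Module.Finite ℂ (MonoidAlgebra ℂ G) := inferInstance
  have : IsNoetherianRing (MonoidAlgebra ℂ G) := isNoetherian_of_tower ℂ inferInstance
  have top := IsSemisimpleModule.sSup_simples_eq_top (MonoidAlgebra ℂ G) (MonoidAlgebra ℂ G)
  have h1 : (1 : MonoidAlgebra ℂ G) ∈ sSup {m : Submodule (MonoidAlgebra ℂ G) (MonoidAlgebra ℂ G) |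
      IsSimpleModule (MonoidAlgebra ℂ G) m} := by rw [top]; trivial
  have h2 : ∀ x ∈ sSup {m : Submodule (MonoidAlgebra ℂ G) (MonoidAlgebra ℂ G) |
      IsSimpleModule (MonoidAlgebra ℂ G) m}, a * x = 0 := by
    intro x hx
    rw [sSup_eq_iSup'] at hx
    induction hx using Submodule.iSup_induction' with
    | mem m x hx =>
      have : IsSimpleModule (MonoidAlgebra ℂ G) m.1 := m.2
      exact congrArg Subtype.val (aux_module f hf hV m.1 ⟨x, hx⟩)
    | zero => simp
    | add x y _ _ hx hy => rw [mul_add, hx, hy, add_zero]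
  have h3 := h2 1 h1
  rw [mul_one] at h3
  ext g
  have h4 := congrArg (fun b : MonoidAlgebra ℂ G => b.coeff g) h3
  simpa [a, MonoidAlgebra.coeff_single, Finsupp.single_apply] using h4

def aux_inv (G : Type) [Group G] : ConjClasses G → ConjClasses G :=
  Quotient.map (fun g => g⁻¹) (fun a b h => by
    obtain ⟨c, hc⟩ := isConj_iff.1 h
    exact isConj_iff.2 ⟨c, by rw [← hc]; group⟩)

theorem aux_inv_mk (g : G) : aux_inv G (ConjClasses.mk g) = ConjClasses.mk g⁻¹ := rfl

def aux_irr (G : Type) [Group G] : Set (ConjClasses G → ℂ) :=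
  {φ | ∃ V : FDRep ℂ G, Simple V ∧ ∀ g, φ (ConjClasses.mk g) = V.character g}

theorem aux_exists (V : FDRep ℂ G) [Simple V] : ∃ φ ∈ aux_irr G, ∀ g, φ (ConjClasses.mk g) = V.character g := by
  let φ : ConjClasses G → ℂ := Quotient.lift V.character (fun a b h => by
    obtain ⟨c, hc⟩ := isConj_iff.1 h
    rw [← hc, FDRep.char_conj])
  exact ⟨φ, ⟨V, inferInstance, fun g => rfl⟩, fun g => rfl⟩

theorem aux_li : LinearIndependent ℂ (Subtype.val : aux_irr G → (ConjClasses G → ℂ)) := by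
  classical
  have hne : (Nat.card G : ℂ) ≠ 0 := by exact_mod_cast Nat.card_pos.ne'
  have : Invertible (Nat.card G : ℂ) := invertibleOfNonzero hne
  have key : ∀ φ ψ : aux_irr G, (Nat.card G : ℂ)⁻¹ * ∑ g : G, φ.1 (ConjClasses.mk g) * ψ.1 (ConjClasses.mk g⁻¹)
      = if φ = ψ then 1 else 0 := by
    rintro ⟨φ, V, hV, hφ⟩ ⟨ψ, W, hW, hψ⟩
    simp only [hφ, hψ]
    rw [FDRep.char_orthonormal]
    split_ifs with h1 h2 h2
    · rfl
    · refine absurd ?_ h2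
      obtain ⟨i⟩ := h1
      ext C
      obtain ⟨g, rfl⟩ := ConjClasses.mk_surjective C
      change φ _ = ψ _
      rw [hφ, hψ, FDRep.char_iso i]
    · exfalso
      have e : φ = ψ := congrArg Subtype.val h2
      have hVW : V.character = W.character := by
        ext g; rw [← hφ, ← hψ, e]
      have h3 := FDRep.char_orthonormal V W
      rw [if_neg h1, ← hVW, aux_simple, inv_mul_cancel₀ hne] at h3
      exact one_ne_zero h3
    · rfl
  rw [linearIndependent_iff']
  intro s c hc ψ hψ
  have h1 : ∑ φ ∈ s, c φ * ((Nat.card G : ℂ)⁻¹ * ∑ g : G, φ.1 (ConjClasses.mk g) * ψ.1 (ConjClasses.mk g⁻¹)) = 0 := by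
    have h2 : ∀ g : G, ∑ φ ∈ s, c φ * φ.1 (ConjClasses.mk g) = 0 := fun g => by
      simpa using congrFun hc (ConjClasses.mk g)
    simp only [Finset.mul_sum]
    rw [Finset.sum_comm]
    refine Finset.sum_eq_zero fun g _ => ?_
    calc _ = (∑ φ ∈ s, c φ * φ.1 (ConjClasses.mk g)) * ((Nat.card G : ℂ)⁻¹ * ψ.1 (ConjClasses.mk g⁻¹)) := by
          rw [Finset.sum_mul]; exact Finset.sum_congr rfl fun _ _ => by ring
      _ = 0 := by rw [h2, zero_mul]
  simp only [key] at h1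
  simpa [hψ] using h1

theorem aux_span : ⊤ ≤ Submodule.span ℂ (Set.range (Subtype.val : aux_irr G → (ConjClasses G → ℂ))) := by
  classical
  by_contra hlt
  rw [top_le_iff, ← ne_eq, ← lt_top_iff_ne_top] at hlt
  obtain ⟨l, hl, hle⟩ := Submodule.exists_le_ker_of_lt_top _ hlt
  apply hl
  let n : ConjClasses G → ℂ := fun C => (Finset.univ.filter (fun g : G => ConjClasses.mk g = C)).card
  have hn : ∀ C, n C ≠ 0 := fun C => by
    obtain ⟨g, rfl⟩ := ConjClasses.mk_surjective C
    simp only [n, ne_eq, Nat.cast_eq_zero]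
    exact (Finset.card_pos.2 ⟨g, by simp⟩).ne'
  have hl' : ∀ φ : ConjClasses G → ℂ, l φ = ∑ g : G, (l (Pi.single (ConjClasses.mk g) 1) / n (ConjClasses.mk g)) * φ (ConjClasses.mk g) := by
    intro φ
    rw [← Finset.sum_fiberwise Finset.univ (fun g : G => ConjClasses.mk g)]
    conv_lhs => rw [LinearMap.pi_apply_eq_sum_univ l φ]
    refine Finset.sum_congr rfl fun C _ => ?_
    have : ∀ g ∈ Finset.univ.filter (fun g : G => ConjClasses.mk g = C), (l (Pi.single (ConjClasses.mk g) 1) / n (ConjClasses.mk g)) * φ (ConjClasses.mk g) = (l (Pi.single C 1) / n C) * φ C := by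
      intro g hg
      rw [(Finset.mem_filter.1 hg).2]
    rw [Finset.sum_congr rfl this, Finset.sum_const, nsmul_eq_mul]
    change _ = n C * _
    have hs : (fun j => if C = j then (1:ℂ) else 0) = Pi.single C 1 := by
      ext j; simp [Pi.single_apply, eq_comm]
    rw [hs, smul_eq_mul]
    field_simp [hn C]
  have hz := aux_complete (fun g : G => l (Pi.single (ConjClasses.mk g) 1) / n (ConjClasses.mk g)) (by
    intro g h
    have : ConjClasses.mk (h * g * h⁻¹) = ConjClasses.mk g :=
      ConjClasses.mk_eq_mk_iff_isConj.2 (isConj_iff.2 ⟨h, rfl⟩).symm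
    simp only [this]) (by
    intro V hV
    obtain ⟨φ, hφ, h⟩ := aux_exists V
    simp only [← h]
    rw [← hl']
    exact hle (Submodule.subset_span ⟨⟨φ, hφ⟩, rfl⟩))
  refine LinearMap.ext fun φ => ?_
  rw [hl', LinearMap.zero_apply]
  refine Finset.sum_eq_zero fun g _ => ?_
  have h := congrFun hz g
  simp only [Pi.zero_apply] at h
  rw [h, zero_mul]

theorem aux_card : Nat.card {χ : G → ℂ |
        (∃ W : FDRep ℂ G, Simple W ∧ χ = W.character) ∧
          ∀ g : G, ∃ r : ℝ, χ g = (r : ℂ)} ≤ Nat.card {C : ConjClasses G // aux_inv G C = C} := by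
  classical
  let b := Module.Basis.mk (aux_li (G := G)) aux_span
  have hfin : Finite (aux_irr G) := Module.Finite.finite_basis b
  let τ : (ConjClasses G → ℂ) →ₗ[ℂ] (ConjClasses G → ℂ) := LinearMap.funLeft ℂ ℂ (aux_inv G)
  have hinv : ∀ C, aux_inv G (aux_inv G C) = C := fun C => by
    obtain ⟨g, rfl⟩ := ConjClasses.mk_surjective C
    simp [aux_inv_mk]
  let p : aux_irr G → aux_irr G := fun φ => ⟨φ.1 ∘ aux_inv G, by
    obtain ⟨φ, V, hV, h⟩ := φ
    refine ⟨FDRep.of (Representation.dual V.ρ), ?_, fun g => ?_⟩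
    · rw [FDRep.simple_iff_char_is_norm_one]
      simp only [FDRep.char_dual]
      rw [← aux_simple V, ← Equiv.sum_comp (Equiv.inv G)]
      simp
    · rw [FDRep.char_dual]
      simp [aux_inv_mk, h]⟩
  have h1 := aux_trace b τ p (fun φ => by simp [b, τ, p]; rfl)
  have h2 := aux_trace (Pi.basisFun ℂ (ConjClasses G)) τ (aux_inv G) (fun C => by
    ext D
    simp only [τ, Pi.basisFun_apply, LinearMap.funLeft_apply, Pi.single_apply]
    congr 1
    exact propext ⟨fun h => by rw [← h, hinv], fun h => by rw [h, hinv]⟩)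
  have h3 : Nat.card {φ : aux_irr G // p φ = φ} = Nat.card {C : ConjClasses G // aux_inv G C = C} := by
    exact_mod_cast h1.symm.trans h2
  rw [← h3]
  have hs : ∀ χ : {χ : G → ℂ |
        (∃ W : FDRep ℂ G, Simple W ∧ χ = W.character) ∧
          ∀ g : G, ∃ r : ℝ, χ g = (r : ℂ)}, ∃ φ : {φ : aux_irr G // p φ = φ}, ∀ g, φ.1.1 (ConjClasses.mk g) = χ.1 g := by
    rintro ⟨χ, ⟨W, hW, rfl⟩, hr⟩
    obtain ⟨φ, hφ, h⟩ := aux_exists W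
    refine ⟨⟨⟨φ, hφ⟩, ?_⟩, h⟩
    ext C
    obtain ⟨g, rfl⟩ := ConjClasses.mk_surjective C
    simp only [p, Function.comp, aux_inv_mk, h]
    obtain ⟨r, hr⟩ := hr g
    rw [aux_conj, hr]
    exact Complex.conj_ofReal r
  choose F hF using hs
  refine Nat.card_le_card_of_injective F fun χ ψ e => ?_
  ext g
  rw [← hF, ← hF, e]
end aux

theorem aux_part1 {G : Type} [Group G] [Fintype G]
    (O : Subgroup G) [O.Normal] (hOodd : Odd (Nat.card O)) (V : FDRep ℂ G) (hV : Simple V)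
    (hb : (∑ g ∈ Finset.univ.filter (fun g : G => Odd (orderOf g)), V.character g) ≠ 0) (x : G) (hx : x ∈ O) :
    V.character x = V.character 1 := by
  classical
  let f : G → ℂ := fun g => if Odd (orderOf g) then 1 else 0
  have hf : ∀ g h, f (h * g * h⁻¹) = f g := fun g h => by
    have : orderOf (h * g * h⁻¹) = orderOf g := MulEquiv.orderOf_eq (MulAut.conj h) g
    simp only [f, this]
  obtain ⟨c, hc⟩ := aux_scalar V.ρ (aux_simple V) _ (aux_central V.ρ f hf)
  have hmul : ∀ g, ∀ x ∈ O, Odd (orderOf g) → Odd (orderOf (x * g)) := by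
    intro g x hx hg
    have h1 : (x * g) ^ orderOf g ∈ O := by
      rw [← QuotientGroup.eq_one_iff]
      rw [QuotientGroup.mk_pow, QuotientGroup.mk_mul, (QuotientGroup.eq_one_iff x).2 hx, one_mul,
        ← QuotientGroup.mk_pow, pow_orderOf_eq_one, QuotientGroup.mk_one]
    have h2 : (x * g) ^ (orderOf g * Nat.card O) = 1 := by
      rw [pow_mul]
      have := pow_card_eq_one' (G := O) (x := ⟨_, h1⟩)
      exact congrArg Subtype.val this
    exact Odd.of_dvd_nat (hg.mul hOodd) (orderOf_dvd_of_pow_eq_one h2)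
  have hfx : ∀ g, f (x⁻¹ * g) = f g := by
    intro g
    have : Odd (orderOf (x⁻¹ * g)) ↔ Odd (orderOf g) :=
      ⟨fun h => by simpa using hmul _ x hx h, hmul g _ (O.inv_mem hx)⟩
    simp only [f, this]
  have hT : V.ρ x ∘ₗ (∑ g, f g • V.ρ g) = ∑ g, f g • V.ρ g := by
    rw [← Equiv.sum_comp (Equiv.mulLeft x⁻¹) (fun g => f g • V.ρ g)]
    ext v
    have hxx : ∀ w, V.ρ x (V.ρ x⁻¹ w) = w := fun w => by
      rw [← Module.End.mul_apply, ← map_mul, mul_inv_cancel, map_one, Module.End.one_apply]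
    have h := Equiv.sum_comp (Equiv.mulLeft x⁻¹) (fun g => f g • V.ρ g v)
    simp only [Equiv.coe_mulLeft, hfx] at h
    simp [LinearMap.sum_apply, map_sum, hfx, hxx]
    simpa using h.symm
  have hc0 : c ≠ 0 := by
    rintro rfl
    apply hb
    have := congrArg (LinearMap.trace ℂ V) hc
    simp only [map_sum, map_smul, zero_smul, map_zero, smul_eq_mul] at this
    rw [Finset.sum_filter]
    refine Eq.trans ?_ this
    refine Finset.sum_congr rfl fun g _ => ?_
    simp [f, FDRep.character]
  rw [hc] at hT
  have : V.ρ x = 1 := by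
    ext v
    have := LinearMap.congr_fun hT v
    simp only [LinearMap.comp_apply, LinearMap.smul_apply, LinearMap.id_apply, map_smul] at this
    exact smul_right_injective _ hc0 this
  simp [FDRep.character, this]

theorem aux_part2 {H : Type} [Group H] [Finite H] (S : Sylow 2 H) (hS : (S : Subgroup H).Normal)
    (hodd : Odd (Nat.card (H ⧸ (S : Subgroup H)))) (x h : H) (hx : h * x * h⁻¹ = x⁻¹) :
    x ∈ (S : Subgroup H) ∧ ∃ s ∈ (S : Subgroup H), s⁻¹ * x * s = x⁻¹ := by
  -- odd powers of h invert x
  set N := Nat.card (H ⧸ (S : Subgroup H)) with hN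
  have hmem : ∀ y : H, y ^ N ∈ (S : Subgroup H) := fun y => by
    rw [← QuotientGroup.eq_one_iff, QuotientGroup.mk_pow]
    exact pow_card_eq_one'
  have h2 : ∀ k : ℕ, h ^ (2 * k + 1) * x * (h ^ (2 * k + 1))⁻¹ = x⁻¹ := by
    intro k
    induction k with
    | zero => simpa using hx
    | succ k ih =>
      have hx' : h * x⁻¹ * h⁻¹ = x := by
        have := congrArg (·⁻¹) hx
        simpa [mul_assoc] using this
      calc h ^ (2 * (k+1) + 1) * x * (h ^ (2 * (k+1) + 1))⁻¹ 
          = h * (h * (h ^ (2 * k + 1) * x * (h ^ (2 * k + 1))⁻¹) * h⁻¹) * h⁻¹ := by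
            rw [show 2 * (k+1) + 1 = (2 * k + 1) + 1 + 1 by ring, pow_succ' h (2 * k + 1 + 1), pow_succ' h (2 * k + 1)]
            simp only [mul_inv_rev, mul_assoc]
        _ = x⁻¹ := by rw [ih, hx', hx]
  obtain ⟨k, hk⟩ := hodd
  have hs : h ^ N ∈ (S : Subgroup H) := hmem h
  have hinv : h ^ N * x * (h ^ N)⁻¹ = x⁻¹ := by rw [hk]; exact h2 k
  refine ⟨?_, (h ^ N)⁻¹, inv_mem hs, by simpa using hinv⟩
  have e : ((x : H ⧸ (S : Subgroup H))) = (x : H ⧸ (S : Subgroup H))⁻¹ := by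
    have := congrArg (QuotientGroup.mk (s := (S : Subgroup H))) hinv
    simpa only [QuotientGroup.mk_mul, QuotientGroup.mk_inv, (QuotientGroup.eq_one_iff _).2 hs, one_mul, inv_one, mul_one] using this
  rw [← QuotientGroup.eq_one_iff]
  have h3 : (x : H ⧸ (S : Subgroup H)) ^ 2 = 1 := by
    rw [pow_two]; nth_rewrite 1 [e]; simp
  have h4 : (x : H ⧸ (S : Subgroup H)) ^ N = 1 := pow_card_eq_one'
  rwa [hk, pow_succ, pow_mul, h3, one_pow, one_mul] at h4

/-- Suppose `G = O_{2',2,2'}(G)`, i.e. `Ḡ = G/O_{2'}(G)` has a normal Sylow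
2-subgroup `S̄` with `Ḡ/S̄` of odd order.  Then every real-valued irreducible
character of `G` in the principal 2-block contains `O_{2'}(G)` in its kernel; and
the number of real-valued irreducible characters of `G/O_{2'}(G)` is at most the
number of elements of `S̄` inverted by conjugation within `S̄`. -/
theorem real_chars_of_principal_block {G : Type} [Group G] [Fintype G]
    (O : Subgroup G) [O.Normal] (hOodd : Odd (Nat.card O))
    (hOmax : ∀ N : Subgroup G, N.Normal → Odd (Nat.card N) → N ≤ O)
    (Sbar : Sylow 2 (G ⧸ O)) (hSbar : (Sbar : Subgroup (G ⧸ O)).Normal)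
    (hquot : Odd (Nat.card ((G ⧸ O) ⧸ (Sbar : Subgroup (G ⧸ O))))) :
    (∀ V : FDRep ℂ G, Simple V → (∀ g : G, ∃ r : ℝ, V.character g = (r : ℂ)) →
        InPrincipal2Block V → ∀ x ∈ O, V.character x = V.character 1) ∧
    Nat.card {χ : (G ⧸ O) → ℂ |
        (∃ W : FDRep ℂ (G ⧸ O), Simple W ∧ χ = W.character) ∧
          ∀ g : G ⧸ O, ∃ r : ℝ, χ g = (r : ℂ)} ≤
      Nat.card {x : G ⧸ O // x ∈ (Sbar : Subgroup (G ⧸ O)) ∧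
        ∃ s ∈ (Sbar : Subgroup (G ⧸ O)), s⁻¹ * x * s = x⁻¹} := by
  classical
  have : Fintype (G ⧸ O) := Fintype.ofFinite _
  refine ⟨fun V hV _ hb x hx => aux_part1 O hOodd V hV hb x hx, aux_card.trans ?_⟩
  have hs : ∀ C : {C : ConjClasses (G ⧸ O) // aux_inv (G ⧸ O) C = C}, ∃ y : {x : G ⧸ O // x ∈ (Sbar : Subgroup (G ⧸ O)) ∧
        ∃ s ∈ (Sbar : Subgroup (G ⧸ O)), s⁻¹ * x * s = x⁻¹}, ConjClasses.mk y.1 = C.1 := by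
    rintro ⟨C, hC⟩
    obtain ⟨g, rfl⟩ := ConjClasses.mk_surjective C
    rw [aux_inv_mk, ConjClasses.mk_eq_mk_iff_isConj] at hC
    obtain ⟨h, hh⟩ := isConj_iff.1 hC.symm
    exact ⟨⟨g, aux_part2 Sbar hSbar hquot g h hh⟩, rfl⟩
  choose F hF using hs
  refine Nat.card_le_card_of_injective F fun C D e => ?_
  ext
  rw [← hF, ← hF, e]
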